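/- arXiv:2004.03440 — 2 statements merged into one kernel-verified Lean document; each statement's English description precedes it below -/
import Mathlib

section
/- Let d ≥ 1 and let θ be a smooth, strictly positive, ℤ^d-periodic function on ℝ^d. Then ∫_{𝕋^d} |∇(θ^{1/2})|^4 dx ≤ (9/16) ∫_{𝕋^d} (Δθ)^2 dx, where both integrals are taken over the fundamental domain [0,1)^d. -/
open MeasureTheory Real

/-- Partial derivative `∂ᵢ f` of a function on `ℝᵈ` (as `EuclideanSpace`). -/
noncomputable def pder {d : ℕ} (i : Fin d) (f : EuclideanSpace ℝ (Fin d) → ℝ)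
    (x : EuclideanSpace ℝ (Fin d)) : ℝ :=
  fderiv ℝ f x (EuclideanSpace.single i 1)

/-- The Laplacian `Δ f = ∑ᵢ ∂ᵢ∂ᵢ f`. -/
noncomputable def lap {d : ℕ} (f : EuclideanSpace ℝ (Fin d) → ℝ)
    (x : EuclideanSpace ℝ (Fin d)) : ℝ :=
  ∑ i, pder i (pder i f) x

/-- Squared norm of the gradient, `|∇f|² = ∑ᵢ (∂ᵢ f)²`. -/
noncomputable def gradSq {d : ℕ} (f : EuclideanSpace ℝ (Fin d) → ℝ)
    (x : EuclideanSpace ℝ (Fin d)) : ℝ :=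
  ∑ i, (pder i f x) ^ 2

/-- Squared Frobenius norm of the Hessian, `|∇∇f|² = ∑ᵢⱼ (∂ᵢ∂ⱼ f)²`. -/
noncomputable def hessSq {d : ℕ} (f : EuclideanSpace ℝ (Fin d) → ℝ)
    (x : EuclideanSpace ℝ (Fin d)) : ℝ :=
  ∑ i, ∑ j, (pder i (pder j f) x) ^ 2

/-- The fundamental domain `[0,1)^d` of the torus `𝕋^d`. -/
def fundDom (d : ℕ) : Set (EuclideanSpace ℝ (Fin d)) :=
  {x | ∀ i, 0 ≤ x i ∧ x i < 1}

/-- `ℤ^d`-periodicity of a function on `ℝ^d`. -/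
def ZPeriodic {d : ℕ} (f : EuclideanSpace ℝ (Fin d) → ℝ) : Prop :=
  ∀ (x : EuclideanSpace ℝ (Fin d)) (k : Fin d → ℤ),
    f (x + (WithLp.equiv 2 (Fin d → ℝ)).symm (fun i => (k i : ℝ))) = f x

namespace Bernis

variable {d : ℕ}

theorem smooth_pder {f : EuclideanSpace ℝ (Fin d) → ℝ} (hf : ContDiff ℝ (⊤ : ℕ∞) f) (i : Fin d) :
    ContDiff ℝ (⊤ : ℕ∞) (pder i f) := by
  have h : ContDiff ℝ (⊤ : ℕ∞) (fderiv ℝ f) := hf.fderiv_right (by simp)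
  exact h.clm_apply contDiff_const

theorem per_pder {f : EuclideanSpace ℝ (Fin d) → ℝ} (hf : ZPeriodic f) (i : Fin d) :
    ZPeriodic (pder i f) := by
  intro x k
  unfold pder
  rw [← fderiv_comp_add_right]
  congr 2
  funext y
  exact hf y k

theorem smooth_diff {f : EuclideanSpace ℝ (Fin d) → ℝ} (hf : ContDiff ℝ (⊤ : ℕ∞) f) (x) :
    DifferentiableAt ℝ f x :=
  (hf.differentiable (by simp)) x

theorem pder_mul {f g : EuclideanSpace ℝ (Fin d) → ℝ} (hf : ContDiff ℝ (⊤ : ℕ∞) f)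
    (hg : ContDiff ℝ (⊤ : ℕ∞) g) (i : Fin d) (x) :
    pder i (fun y => f y * g y) x = pder i f x * g x + f x * pder i g x := by
  unfold pder
  rw [fderiv_fun_mul (smooth_diff hf x) (smooth_diff hg x)]
  simp
  ring

theorem pder_sum {g : Fin d → EuclideanSpace ℝ (Fin d) → ℝ}
    (hg : ∀ j, ContDiff ℝ (⊤ : ℕ∞) (g j)) (i : Fin d) (x) :
    pder i (fun y => ∑ j, g j y) x = ∑ j, pder i (g j) x := by
  unfold pder
  rw [fderiv_fun_sum (fun j _ => smooth_diff (hg j) x)]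
  simp

theorem pder_comp {f : EuclideanSpace ℝ (Fin d) → ℝ} (hf : ContDiff ℝ (⊤ : ℕ∞) f) {φ : ℝ → ℝ}
    {c : ℝ} (i : Fin d) (x) (hφ : HasDerivAt φ c (f x)) :
    pder i (fun y => φ (f y)) x = c * pder i f x := by
  unfold pder
  have := (hφ.comp_hasFDerivAt x (smooth_diff hf x).hasFDerivAt).fderiv
  have h2 : (fun y => φ (f y)) = φ ∘ f := rfl
  rw [h2, this]
  simp

theorem pder_comm {f : EuclideanSpace ℝ (Fin d) → ℝ} (hf : ContDiff ℝ (⊤ : ℕ∞) f) (i j : Fin d) :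
    pder i (pder j f) = pder j (pder i f) := by
  funext x
  have hs : IsSymmSndFDerivAt ℝ f x :=
    (hf.contDiffAt).isSymmSndFDerivAt (by
      rw [minSmoothness_of_isRCLikeNormedField]; exact WithTop.coe_le_coe.2 (OrderTop.le_top (2 : ℕ∞)))
  have h : ContDiff ℝ (⊤ : ℕ∞) (fderiv ℝ f) := hf.fderiv_right (by simp)
  have hd : DifferentiableAt ℝ (fderiv ℝ f) x := (h.differentiable (by simp)) x
  have key : ∀ v w, fderiv ℝ (fun y => fderiv ℝ f y v) x w = fderiv ℝ (fderiv ℝ f) x w v := by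
    intro v w
    rw [fderiv_clm_apply hd (differentiableAt_const v)]
    simp
  unfold pder
  rw [key, key, hs]

theorem fundDom_preimage : (WithLp.toLp 2) ⁻¹' (fundDom d) =
    Set.pi Set.univ (fun _ : Fin d => Set.Ico (0:ℝ) 1) := by
  ext x
  simp [fundDom, Set.mem_pi]

theorem setInt (g : EuclideanSpace ℝ (Fin d) → ℝ) :
    ∫ x in fundDom d, g x = ∫ x in Set.Icc (0 : Fin d → ℝ) 1, g (WithLp.toLp 2 x) := by
  have he : MeasurableEmbedding (@WithLp.toLp 2 (Fin d → ℝ)) :=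
    (MeasurableEquiv.toLp 2 (Fin d → ℝ)).measurableEmbedding
  rw [← (PiLp.volume_preserving_toLp (Fin d)).setIntegral_preimage_emb he, fundDom_preimage]
  exact setIntegral_congr_set Measure.univ_pi_Ico_ae_eq_Icc

theorem integ {g : EuclideanSpace ℝ (Fin d) → ℝ} (hg : Continuous g) :
    IntegrableOn g (fundDom d) := by
  have he : MeasurableEmbedding (@WithLp.toLp 2 (Fin d → ℝ)) :=
    (MeasurableEquiv.toLp 2 (Fin d → ℝ)).measurableEmbedding
  rw [← (PiLp.volume_preserving_toLp (Fin d)).integrableOn_comp_preimage he, fundDom_preimage]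
  have hc : Continuous (g ∘ (@WithLp.toLp 2 (Fin d → ℝ))) :=
    hg.comp (PiLp.continuous_toLp 2 _)
  refine (hc.continuousOn.integrableOn_compact (isCompact_Icc (a := (0 : Fin d → ℝ)) (b := 1))).mono_set ?_
  intro x hx
  simp only [Set.mem_pi, Set.mem_univ, true_imp_iff, Set.mem_Ico] at hx
  exact ⟨fun i => (hx i).1, fun i => (hx i).2.le⟩

theorem int_pder {f : EuclideanSpace ℝ (Fin d) → ℝ} (hf : ContDiff ℝ (⊤ : ℕ∞) f)
    (hp : ZPeriodic f) (i : Fin d) : ∫ x in fundDom d, pder i f x = 0 := by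
  obtain _ | n := d
  · exact i.elim0
  rw [setInt]
  let L : (Fin (n+1) → ℝ) →L[ℝ] EuclideanSpace ℝ (Fin (n+1)) :=
    ((PiLp.continuousLinearEquiv 2 ℝ (fun _ : Fin (n+1) => ℝ)).symm : _ →L[ℝ] _)
  have hL : ∀ x, L x = WithLp.toLp 2 x := fun x => rfl
  have hsum : ∀ x : Fin (n+1) → ℝ, ∑ j, (if j = i then (fderiv ℝ f (L x)).comp L else 0)
      (Pi.single j 1) = pder i f (WithLp.toLp 2 x) := by
    intro x
    rw [Finset.sum_eq_single i]
    · simp [pder, hL, EuclideanSpace.single]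
    · intro j _ hj; simp [hj]
    · simp
  have hcp : Continuous (fun x : Fin (n+1) → ℝ => pder i f (WithLp.toLp 2 x)) :=
    (smooth_pder hf i).continuous.comp L.continuous
  have := integral_divergence_of_hasFDerivAt_off_countable' (E := ℝ) (0 : Fin (n+1) → ℝ) 1
    (by intro j; simp)
    (fun j x => if j = i then f (L x) else 0)
    (fun j x => if j = i then (fderiv ℝ f (L x)).comp L else 0) ∅ (by simp)
    (by
      intro j
      by_cases hj : j = i
      · simp only [hj, if_true]
        exact (hf.continuous.comp L.continuous).continuousOn
      · simp only [hj, if_false]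
        exact continuousOn_const)
    (by
      intro x _ j
      by_cases hj : j = i
      · simp only [hj, if_true]
        exact (smooth_diff hf (L x)).hasFDerivAt.comp x L.hasFDerivAt
      · simp only [hj, if_false]
        exact hasFDerivAt_const _ _)
    (by
      simp only [hsum]
      exact hcp.continuousOn.integrableOn_compact isCompact_Icc)
  simp only [hsum] at this
  rw [this]
  apply Finset.sum_eq_zero
  intro j _
  by_cases hj : j = i
  · simp only [hj, if_true]
    rw [sub_eq_zero]
    congr 1
    funext y
    have h1 := hp (L (i.insertNth 0 y)) (Pi.single i 1)
    simp only [Pi.zero_apply, Pi.one_apply]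
    rw [← h1]
    congr 1
    ext k
    simp only [hL, PiLp.add_apply, WithLp.equiv_symm_apply]
    rcases Fin.eq_self_or_eq_succAbove i k with rfl | ⟨m, rfl⟩
    · simp
    · simp
  · simp [hj]


theorem main_pt (d : ℕ) (a : Fin d → ℝ) (H : Fin d → Fin d → ℝ) (t : ℝ) :
    (t * ∑ i, a i * a i) ^ 2 ≤ 9 * (∑ i, H i i) ^ 2
      + 6 * (∑ i, ∑ j, (H i j * H i j - H i i * H j j))
      - 2 * ∑ i, (-t ^ 2 * a i * ((∑ j, a j * a j) * a i)
        + t * ((∑ j, (H i j * a j + a j * H i j)) * a i + (∑ j, a j * a j) * H i i)) := by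
  have e1 : ∑ i, ∑ j, (H i j * H i j - H i i * H j j)
      = (∑ i, ∑ j, H i j ^ 2) - (∑ i, H i i) ^ 2 := by
    simp only [Finset.sum_sub_distrib, sq, Finset.sum_mul_sum]
  have e2 : ∑ i, (-t ^ 2 * a i * ((∑ j, a j * a j) * a i)
        + t * ((∑ j, (H i j * a j + a j * H i j)) * a i + (∑ j, a j * a j) * H i i))
      = - (t * ∑ i, a i * a i) ^ 2 + 2 * (∑ i, ∑ j, t * a i * a j * H i j)
        + (t * ∑ i, a i * a i) * ∑ i, H i i := by
    set S := ∑ j, a j * a j with hS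
    have h1 : (t * S) ^ 2 = ∑ i, t ^ 2 * S * (a i * a i) := by
      rw [← Finset.mul_sum, ← hS]; ring
    have h0 : t * S * ∑ i, H i i = ∑ i, t * S * H i i := Finset.mul_sum _ _ _
    rw [h1, h0, Finset.mul_sum (a := (2 : ℝ)), ← Finset.sum_neg_distrib, ← Finset.sum_add_distrib,
      ← Finset.sum_add_distrib]
    refine Finset.sum_congr rfl fun i _ => ?_
    have h2 : ∑ j, (H i j * a j + a j * H i j) = 2 * ∑ j, a j * H i j := by
      rw [Finset.mul_sum]; exact Finset.sum_congr rfl fun j _ => by ring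
    have h3 : ∑ j, t * a i * a j * H i j = t * a i * ∑ j, a j * H i j := by
      rw [Finset.mul_sum]; exact Finset.sum_congr rfl fun j _ => by ring
    rw [h2, h3]; ring
  have e3 : (t * ∑ i, a i * a i) ^ 2 = ∑ i, ∑ j, (t * a i * a j) ^ 2 := by
    rw [mul_pow, sq (∑ i, a i * a i), Finset.sum_mul_sum, Finset.mul_sum]
    refine Finset.sum_congr rfl fun i _ => ?_
    rw [Finset.mul_sum]
    exact Finset.sum_congr rfl fun j _ => by ring
  have e4 : 2 * (∑ i, ∑ j, t * a i * a j * H i j)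
      ≤ 3 * (∑ i, ∑ j, H i j ^ 2) + (1 / 3) * (t * ∑ i, a i * a i) ^ 2 := by
    rw [e3]
    simp only [Finset.mul_sum]
    rw [← Finset.sum_add_distrib]
    refine Finset.sum_le_sum fun i _ => ?_
    rw [← Finset.sum_add_distrib]
    refine Finset.sum_le_sum fun j _ => ?_
    nlinarith [sq_nonneg (3 * H i j - t * a i * a j)]
  rw [e1, e2]
  nlinarith [sq_nonneg (t * (∑ i, a i * a i) - 3 * ∑ i, H i i)]

end Bernis

open Bernis

/-- **Multidimensional Bernis inequality** (Proposition `theo:logSob`):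
for smooth positive `θ` on `𝕋^d`, `∫ |∇(θ^{1/2})|⁴ ≤ (9/16) ∫ (Δθ)²`. -/
theorem bernis_sqrt_inequality (d : ℕ) (hd : 1 ≤ d)
    (θ : EuclideanSpace ℝ (Fin d) → ℝ)
    (hsm : ContDiff ℝ (⊤ : ℕ∞) θ)
    (hpos : ∀ x, 0 < θ x)
    (hper : ZPeriodic θ) :
    ∫ x in fundDom d, (gradSq (fun y => Real.sqrt (θ y)) x) ^ 2
      ≤ (9 / 16) * ∫ x in fundDom d, (lap θ x) ^ 2 := by
  classical
  have ha : ∀ i, ContDiff ℝ (⊤ : ℕ∞) (pder i θ) := fun i => smooth_pder hsm i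
  have hH : ∀ i j, ContDiff ℝ (⊤ : ℕ∞) (pder i (pder j θ)) := fun i j => smooth_pder (ha j) i
  have pa : ∀ i, ZPeriodic (pder i θ) := fun i => per_pder hper i
  have pH : ∀ i j, ZPeriodic (pder i (pder j θ)) := fun i j => per_pder (pa j) i
  have ht : ContDiff ℝ (⊤ : ℕ∞) (fun y => (θ y)⁻¹) := hsm.inv fun x => (hpos x).ne'
  have haa : ∀ j, ContDiff ℝ (⊤ : ℕ∞) (fun y => pder j θ y * pder j θ y) :=
    fun j => (ha j).mul (ha j)
  have hS : ContDiff ℝ (⊤ : ℕ∞) (fun y => ∑ j, pder j θ y * pder j θ y) :=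
    ContDiff.sum fun j _ => haa j
  let V : Fin d → EuclideanSpace ℝ (Fin d) → ℝ := fun i y =>
    (θ y)⁻¹ * ((∑ j, pder j θ y * pder j θ y) * pder i θ y)
  have hV : ∀ i, ContDiff ℝ (⊤ : ℕ∞) (V i) := fun i => ht.mul (hS.mul (ha i))
  have pV : ∀ i, ZPeriodic (V i) := by
    intro i x k
    simp only [V, hper x k, fun j => pa j x k]
  have dV : ∀ i x, pder i (V i) x = -((θ x)⁻¹) ^ 2 * pder i θ x *
      ((∑ j, pder j θ x * pder j θ x) * pder i θ x)
      + (θ x)⁻¹ * ((∑ j, (pder i (pder j θ) x * pder j θ x + pder j θ x * pder i (pder j θ) x))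
        * pder i θ x + (∑ j, pder j θ x * pder j θ x) * pder i (pder i θ) x) := by
    intro i x
    simp only [V]
    rw [pder_mul ht (hS.mul (ha i)), pder_mul hS (ha i), pder_sum haa,
      pder_comp hsm (φ := fun u => u⁻¹) i x (hasDerivAt_inv (hpos x).ne')]
    simp only [fun j => pder_mul (ha j) (ha j) i x]
    rw [inv_pow]
  let W : Fin d → Fin d → EuclideanSpace ℝ (Fin d) → ℝ := fun i j y =>
    pder j θ y * pder i (pder j θ) y
  let U : Fin d → Fin d → EuclideanSpace ℝ (Fin d) → ℝ := fun i j y =>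
    pder j θ y * pder i (pder i θ) y
  have hW : ∀ i j, ContDiff ℝ (⊤ : ℕ∞) (W i j) := fun i j => (ha j).mul (hH i j)
  have hU : ∀ i j, ContDiff ℝ (⊤ : ℕ∞) (U i j) := fun i j => (ha j).mul (hH i i)
  have pW : ∀ i j, ZPeriodic (W i j) := by
    intro i j x k
    simp only [W, pa j x k, pH i j x k]
  have pU : ∀ i j, ZPeriodic (U i j) := by
    intro i j x k
    simp only [U, pa j x k, pH i i x k]
  have dWU : ∀ i j x, pder i (W i j) x - pder j (U i j) x =
      pder i (pder j θ) x * pder i (pder j θ) x - pder i (pder i θ) x * pder j (pder j θ) x := by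
    intro i j x
    simp only [W, U]
    rw [pder_mul (ha j) (hH i j), pder_mul (ha j) (hH i i), pder_comm (ha i) j i,
      pder_comm hsm j i]
    ring
  have iV : ∀ i, Integrable (pder i (V i)) (volume.restrict (fundDom d)) :=
    fun i => integ (smooth_pder (hV i) i).continuous
  have iW : ∀ i j, Integrable (pder i (W i j)) (volume.restrict (fundDom d)) :=
    fun i j => integ (smooth_pder (hW i j) i).continuous
  have iU : ∀ i j, Integrable (pder j (U i j)) (volume.restrict (fundDom d)) :=
    fun i j => integ (smooth_pder (hU i j) j).continuous
  have iWU : ∀ i j, Integrable (fun x => pder i (W i j) x - pder j (U i j) x)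
      (volume.restrict (fundDom d)) := fun i j => (iW i j).sub (iU i j)
  have IQ : ∫ x in fundDom d, ∑ i, pder i (V i) x = 0 := by
    rw [integral_finsetSum _ fun i _ => iV i]
    exact Finset.sum_eq_zero fun i _ => int_pder (hV i) (pV i) i
  have IR : ∫ x in fundDom d, ∑ i, ∑ j, (pder i (W i j) x - pder j (U i j) x) = 0 := by
    rw [integral_finsetSum _ fun i _ => integrable_finsetSum _ fun j _ => iWU i j]
    refine Finset.sum_eq_zero fun i _ => ?_
    rw [integral_finsetSum _ fun j _ => iWU i j]
    refine Finset.sum_eq_zero fun j _ => ?_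
    rw [integral_sub (iW i j) (iU i j), int_pder (hW i j) (pW i j) i, int_pder (hU i j) (pU i j) j,
      sub_zero]
  have iQ : Integrable (fun x => ∑ i, pder i (V i) x) (volume.restrict (fundDom d)) :=
    integrable_finsetSum _ fun i _ => iV i
  have iR : Integrable (fun x => ∑ i, ∑ j, (pder i (W i j) x - pder j (U i j) x))
      (volume.restrict (fundDom d)) :=
    integrable_finsetSum _ fun i _ => integrable_finsetSum _ fun j _ => iWU i j
  have hlap : ContDiff ℝ (⊤ : ℕ∞) (lap θ) := ContDiff.sum fun i _ => hH i i
  have iL : Integrable (fun x => (lap θ x) ^ 2) (volume.restrict (fundDom d)) :=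
    integ (hlap.continuous.pow 2)
  have hG : ∀ x, (gradSq (fun y => Real.sqrt (θ y)) x) ^ 2
      = (1 / 16) * ((θ x)⁻¹ * ∑ j, pder j θ x * pder j θ x) ^ 2 := by
    intro x
    have : gradSq (fun y => Real.sqrt (θ y)) x
        = (1 / 4) * ((θ x)⁻¹ * ∑ j, pder j θ x * pder j θ x) := by
      unfold gradSq
      rw [Finset.mul_sum, Finset.mul_sum]
      refine Finset.sum_congr rfl fun i _ => ?_
      rw [pder_comp hsm (φ := Real.sqrt) i x (Real.hasDerivAt_sqrt (hpos x).ne')]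
      have h1 := Real.sq_sqrt (hpos x).le
      rw [mul_pow, div_pow, mul_pow, h1]
      have := (hpos x).ne'
      field_simp
      ring
    rw [this]; ring
  have iG : Integrable (fun x => (gradSq (fun y => Real.sqrt (θ y)) x) ^ 2)
      (volume.restrict (fundDom d)) := by
    simp only [hG]
    exact integ (continuous_const.mul ((ht.continuous.mul hS.continuous).pow 2))
  have hpt : ∀ x, (gradSq (fun y => Real.sqrt (θ y)) x) ^ 2 ≤
      (9 / 16) * (lap θ x) ^ 2 + (6 / 16) * (∑ i, ∑ j, (pder i (W i j) x - pder j (U i j) x))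
        - (2 / 16) * ∑ i, pder i (V i) x := by
    intro x
    rw [hG]
    simp only [dV, dWU]
    have := main_pt d (fun i => pder i θ x) (fun i j => pder i (pder j θ) x) (θ x)⁻¹
    unfold lap
    linarith
  have hfin := integral_mono iG (((iL.const_mul (9 / 16)).add (iR.const_mul (6 / 16))).sub
    (iQ.const_mul (2 / 16))) hpt
  refine hfin.trans (le_of_eq ?_)
  rw [integral_sub' ((iL.const_mul (9 / 16)).add (iR.const_mul (6 / 16))) (iQ.const_mul (2 / 16)),
    integral_add' (iL.const_mul (9 / 16)) (iR.const_mul (6 / 16)), integral_const_mul,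
    integral_const_mul, integral_const_mul, IQ, IR]
  ring
end

section
/- Let d ≥ 1 and let h be a smooth, strictly positive solution on [0,T] of the Boussinesq equation ∂_t h − div(h ∇h) = 0 on 𝕋^d. Then for every t ∈ [0,T], (d/dt) ∫_{𝕋^d} h |∇h|^2 dx + (1/6) ∫_{𝕋^d} |∇h|^4 dx + (1/2) ∫_{𝕋^d} h^2 (Δh)^2 dx ≤ 0. -/
open MeasureTheory Real

open scoped ContDiff

/-- directional derivative on space-time -/
noncomputable def DD {d : ℕ} (v : ℝ × EuclideanSpace ℝ (Fin d))
    (F : ℝ × EuclideanSpace ℝ (Fin d) → ℝ) (z : ℝ × EuclideanSpace ℝ (Fin d)) : ℝ :=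
  fderiv ℝ F z v

/-- space direction -/
noncomputable def ee {d : ℕ} (i : Fin d) : ℝ × EuclideanSpace ℝ (Fin d) :=
  (0, EuclideanSpace.single i 1)

/-- time direction -/
noncomputable def tt {d : ℕ} : ℝ × EuclideanSpace ℝ (Fin d) := (1, 0)

/-- space periodicity -/
def SPer {d : ℕ} (F : ℝ × EuclideanSpace ℝ (Fin d) → ℝ) : Prop :=
  ∀ (z : ℝ × EuclideanSpace ℝ (Fin d)) (k : Fin d → ℤ),
    F (z + (0, WithLp.toLp 2 (fun i => (k i : ℝ)))) = F z

section
variable {d : ℕ} {F G : ℝ × EuclideanSpace ℝ (Fin d) → ℝ}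

theorem DD_smooth (hF : ContDiff ℝ ∞ F) (v) : ContDiff ℝ ∞ (DD v F) := by
  unfold DD
  exact (hF.fderiv_right (m := ∞) (by simp)).clm_apply contDiff_const

theorem DD_per (hF : SPer F) (v) : SPer (DD v F) := by
  intro z k
  unfold DD
  rw [← fderiv_comp_add_right]
  congr 2
  funext w
  exact hF w k

theorem DD_comm (hF : ContDiff ℝ ∞ F) (v w z) : DD v (DD w F) z = DD w (DD v F) z := by
  have hs : IsSymmSndFDerivAt ℝ F z := hF.contDiffAt.isSymmSndFDerivAt (by simp; exact WithTop.coe_le_coe.2 le_top)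
  have hd : Differentiable ℝ (fderiv ℝ F) :=
    (hF.fderiv_right (m := ∞) (by simp)).differentiable (by simp)
  have key : ∀ a b, DD a (DD b F) z = fderiv ℝ (fderiv ℝ F) z a b := by
    intro a b
    unfold DD
    rw [fderiv_clm_apply (hd z) (by fun_prop)]
    simp
  rw [key, key, hs v w]

theorem DD_mul (hF : ContDiff ℝ ∞ F) (hG : ContDiff ℝ ∞ G) (v z) :
    DD v (fun y => F y * G y) z = DD v F z * G z + F z * DD v G z := by
  have h1 := (hF.differentiable (by simp)) z
  have h2 := (hG.differentiable (by simp)) z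
  unfold DD
  rw [fderiv_fun_mul h1 h2]
  simp; ring

theorem DD_add (hF : ContDiff ℝ ∞ F) (hG : ContDiff ℝ ∞ G) (v z) :
    DD v (fun y => F y + G y) z = DD v F z + DD v G z := by
  have h1 := (hF.differentiable (by simp)) z
  have h2 := (hG.differentiable (by simp)) z
  unfold DD
  rw [fderiv_fun_add h1 h2]
  simp

theorem DD_sum {ι : Type*} (s : Finset ι) {F : ι → ℝ × EuclideanSpace ℝ (Fin d) → ℝ}
    (hF : ∀ i, ContDiff ℝ ∞ (F i)) (v z) :
    DD v (fun y => ∑ i ∈ s, F i y) z = ∑ i ∈ s, DD v (F i) z := by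
  unfold DD
  rw [fderiv_fun_sum (fun i _ => ((hF i).differentiable (by simp)) z)]
  simp

theorem DD_const_mul (c : ℝ) (hF : ContDiff ℝ ∞ F) (v z) :
    DD v (fun y => c * F y) z = c * DD v F z := by
  unfold DD
  rw [fderiv_const_mul ((hF.differentiable (by simp)) z)]
  simp

theorem pder_slice (hF : ContDiff ℝ ∞ F) (i t x) :
    pder i (fun y => F (t, y)) x = DD (ee i) F (t, x) := by
  unfold pder DD ee
  have h1 : HasFDerivAt F (fderiv ℝ F (t, x)) (t, x) :=
    ((hF.differentiable (by simp)) (t, x)).hasFDerivAt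
  have h2 := h1.comp x (hasFDerivAt_prodMk_right t x)
  have := h2.fderiv
  simp only [Function.comp_def] at this
  rw [this]; simp

theorem deriv_slice (hF : ContDiff ℝ ∞ F) (t x) :
    HasDerivAt (fun s => F (s, x)) (DD tt F (t, x)) t := by
  unfold DD tt
  have h1 : HasFDerivAt F (fderiv ℝ F (t, x)) (t, x) :=
    ((hF.differentiable (by simp)) (t, x)).hasFDerivAt
  have h2 := (h1.comp t (hasFDerivAt_prodMk_left t x)).hasDerivAt
  simpa [Function.comp_def] using h2

theorem fundDom_eq : fundDom d = (@WithLp.ofLp 2 (Fin d → ℝ)) ⁻¹'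
    (Set.pi Set.univ fun _ => Set.Ico (0:ℝ) 1) := by
  ext x; simp [fundDom, Set.mem_pi]

theorem fundDom_meas : MeasurableSet (fundDom d) := by
  rw [fundDom_eq]
  exact (PiLp.volume_preserving_ofLp (Fin d)).measurable
    (MeasurableSet.univ_pi fun _ => measurableSet_Ico)

/-- closed cube -/
def cube (d : ℕ) : Set (EuclideanSpace ℝ (Fin d)) :=
  (WithLp.toLp 2) '' (Set.Icc (0 : Fin d → ℝ) 1)

theorem cube_compact : IsCompact (cube d) :=
  isCompact_Icc.image (PiLp.continuous_toLp 2 _)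

theorem fundDom_sub : fundDom d ⊆ cube d := by
  intro x hx
  exact ⟨WithLp.ofLp x, ⟨fun i => (hx i).1, fun i => (hx i).2.le⟩, rfl⟩

theorem int_cont {f : EuclideanSpace ℝ (Fin d) → ℝ} (hf : Continuous f) :
    IntegrableOn f (fundDom d) :=
  (hf.continuousOn.integrableOn_compact cube_compact).mono_set fundDom_sub

theorem leibniz (hF : ContDiff ℝ ∞ F) (t : ℝ) :
    HasDerivAt (fun s => ∫ x in fundDom d, F (s, x)) (∫ x in fundDom d, DD tt F (t, x)) t := by
  have hD : Continuous (DD tt F) := (DD_smooth hF tt).continuous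
  have hFc := hF.continuous
  obtain ⟨C, hC⟩ := ((isCompact_Icc (a := t - 1) (b := t + 1)).prod
    (cube_compact (d := d))).exists_bound_of_continuousOn hD.continuousOn
  refine (hasDerivAt_integral_of_dominated_loc_of_deriv_le (s := Set.Icc (t-1) (t+1))
    (F := fun s x => F (s, x)) (F' := fun s x => DD tt F (s, x)) (bound := fun _ => C)
    (Icc_mem_nhds (by linarith) (by linarith)) ?_ ?_ ?_ ?_ ?_ ?_).2
  · exact Filter.Eventually.of_forall fun s => (int_cont (by fun_prop)).aestronglyMeasurable
  · exact int_cont (by fun_prop)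
  · exact (int_cont (f := fun x => DD tt F (t, x)) (by fun_prop)).aestronglyMeasurable
  · filter_upwards [ae_restrict_mem fundDom_meas] with x hx s hs
    exact hC (s, x) ⟨hs, fundDom_sub hx⟩
  · exact int_cont continuous_const
  · exact Filter.Eventually.of_forall fun x s _ => deriv_slice hF s x

theorem int_fund (f : EuclideanSpace ℝ (Fin d) → ℝ) :
    ∫ x in fundDom d, f x = ∫ y in Set.Icc (0 : Fin d → ℝ) 1, f (WithLp.toLp 2 y) := by
  have h1 := (PiLp.volume_preserving_ofLp (Fin d)).setIntegral_preimage_emb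
    (MeasurableEquiv.toLp 2 (Fin d → ℝ)).symm.measurableEmbedding
    (fun y => f (WithLp.toLp 2 y)) (Set.pi Set.univ fun _ => Set.Ico (0:ℝ) 1)
  rw [← fundDom_eq] at h1
  simp only [WithLp.toLp_ofLp] at h1
  rw [h1]
  exact setIntegral_congr_set (Measure.univ_pi_Ico_ae_eq_Icc (f := (0 : Fin d → ℝ)) (g := 1))

theorem div_zero_int (hd : 1 ≤ d) {V : Fin d → ℝ × EuclideanSpace ℝ (Fin d) → ℝ}
    (hV : ∀ i, ContDiff ℝ ∞ (V i)) (hp : ∀ i, SPer (V i)) (t : ℝ) :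
    ∫ x in fundDom d, ∑ i, DD (ee i) (V i) (t, x) = 0 := by
  obtain ⟨n, rfl⟩ : ∃ n, d = n + 1 := ⟨d - 1, by omega⟩
  rw [int_fund]
  let L : (Fin (n+1) → ℝ) →L[ℝ] ℝ × EuclideanSpace ℝ (Fin (n+1)) :=
    (ContinuousLinearMap.inr ℝ ℝ _).comp
      (PiLp.continuousLinearEquiv 2 ℝ (fun _ : Fin (n+1) => ℝ)).symm.toContinuousLinearMap
  have hL : ∀ y, L y = (0, WithLp.toLp 2 y) := fun y => rfl
  have hLc : ∀ y, HasFDerivAt (fun y : Fin (n+1) → ℝ => (t, (WithLp.toLp 2 y : EuclideanSpace ℝ (Fin (n+1))))) L y := by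
    intro y
    have := (L.hasFDerivAt (x := y)).const_add (t, (0 : EuclideanSpace ℝ (Fin (n+1))))
    refine this.congr_of_eventuallyEq (Filter.Eventually.of_forall fun z => ?_)
    simp [hL]
  have hcont : Continuous (fun y : Fin (n+1) → ℝ => (t, (WithLp.toLp 2 y : EuclideanSpace ℝ (Fin (n+1))))) :=
    continuous_iff_continuousAt.2 fun y => (hLc y).continuousAt
  have key := integral_divergence_of_hasFDerivAt_off_countable' (0 : Fin (n+1) → ℝ) 1
    zero_le_one (fun i y => V i (t, WithLp.toLp 2 y))
    (fun i y => (fderiv ℝ (V i) (t, WithLp.toLp 2 y)).comp L) ∅ Set.countable_empty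
    (fun i => ((hV i).continuous.comp hcont).continuousOn)
    (fun y _ i => (((hV i).differentiable (by simp) _).hasFDerivAt).comp y (hLc y))
    (by
      refine ContinuousOn.integrableOn_compact isCompact_Icc ?_
      apply Continuous.continuousOn
      refine continuous_finsetSum _ fun i _ => ?_
      exact ((DD_smooth (hV i) (L (Pi.single i 1))).continuous.comp hcont))
  have h0 : ∀ i y, DD (ee i) (V i) (t, WithLp.toLp 2 y)
      = ((fderiv ℝ (V i) (t, WithLp.toLp 2 y)).comp L) (Pi.single i 1) := by
    intro i y; rfl
  simp only [h0]
  rw [key]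
  apply Finset.sum_eq_zero
  intro i _
  rw [sub_eq_zero]
  congr 1
  funext y
  have := hp i (t, WithLp.toLp 2 (i.insertNth ((0 : Fin (n+1) → ℝ) i) y)) (Pi.single i 1)
  rw [← this]
  congr 1
  ext j
  · simp
  · refine Fin.succAboveCases i ?_ (fun j => ?_) j <;> simp

end

theorem alg_id {d : ℕ} (a u : ℝ) (p w : Fin d → ℝ) (q r r' : Fin d → Fin d → ℝ)
    (hr : ∀ i j, r' i j = r j i) (hu : u = ∑ i, (p i * p i + a * q i i)) :
    (u * (∑ j, p j * p j) + a * ∑ j, (w j * p j + p j * w j))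
      + ((1 / 6) * (∑ j, p j * p j) ^ 2 + (1 / 2) * (a ^ 2 * (∑ j, q j j) ^ 2))
      + ((∑ i, ∑ j, (a * q i j + p i * p j / 3) ^ 2)
          + (1 / 2) * (a * (∑ j, q j j) + (∑ j, p j * p j) / 3) ^ 2)
    = ∑ i, (2 * ((p i * u + a * w i) * p i + a * u * q i i)
      + (-1) * (((p i * a + a * p i) * p i + a * a * q i i) * (∑ j, q j j)
          + a * a * p i * ∑ j, r i j)
      + (∑ j, (((p i * a + a * p i) * p j + a * a * q i j) * q i j + a * a * p j * r' i j))
      + (-(2 / 3)) * ((p i * (∑ j, p j * p j) + a * ∑ j, (q i j * p j + p j * q i j)) * p i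
          + a * (∑ j, p j * p j) * q i i)) := by
  have hR : ∑ i, ∑ j, a * a * p j * r' i j = ∑ i, a * a * p i * ∑ j, r i j := by
    rw [Finset.sum_comm]
    simp only [hr, Finset.mul_sum]
  have e0 : u = (∑ j, p j * p j) + a * ∑ j, q j j := by
    rw [hu, Finset.sum_add_distrib, Finset.mul_sum]
  have e1 : ∑ i, ∑ j, (a * q i j + p i * p j / 3) ^ 2
      = a ^ 2 * (∑ i, ∑ j, q i j * q i j) + (2 / 3) * a * (∑ i, ∑ j, p i * p j * q i j)
        + (∑ j, p j * p j) ^ 2 / 9 := by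
    rw [pow_two (∑ j, p j * p j), Finset.sum_mul_sum, Finset.mul_sum, Finset.mul_sum,
      Finset.sum_div, ← Finset.sum_add_distrib, ← Finset.sum_add_distrib]
    refine Finset.sum_congr rfl fun i _ => ?_
    rw [Finset.mul_sum, Finset.mul_sum,
      Finset.sum_div, ← Finset.sum_add_distrib, ← Finset.sum_add_distrib]
    refine Finset.sum_congr rfl fun j _ => ?_
    ring
  have e2 : ∑ j, (w j * p j + p j * w j) = 2 * ∑ j, w j * p j := by
    rw [Finset.mul_sum]
    refine Finset.sum_congr rfl fun j _ => ?_
    ring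
  have e3 : ∀ i, ∑ j, (((p i * a + a * p i) * p j + a * a * q i j) * q i j + a * a * p j * r' i j)
      = 2 * a * (∑ j, p i * p j * q i j) + a ^ 2 * (∑ j, q i j * q i j)
        + ∑ j, a * a * p j * r' i j := by
    intro i
    rw [Finset.mul_sum, Finset.mul_sum, ← Finset.sum_add_distrib, ← Finset.sum_add_distrib]
    refine Finset.sum_congr rfl fun j _ => ?_
    ring
  have e4 : ∀ i, (∑ j, (q i j * p j + p j * q i j)) * p i = 2 * ∑ j, p i * p j * q i j := by
    intro i
    rw [Finset.mul_sum, Finset.sum_mul]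
    refine Finset.sum_congr rfl fun j _ => ?_
    ring
  rw [e1, e2]
  have e5 : ∀ i, (2 * ((p i * u + a * w i) * p i + a * u * q i i)
      + (-1) * (((p i * a + a * p i) * p i + a * a * q i i) * (∑ j, q j j)
          + a * a * p i * ∑ j, r i j)
      + (∑ j, (((p i * a + a * p i) * p j + a * a * q i j) * q i j + a * a * p j * r' i j))
      + (-(2 / 3)) * ((p i * (∑ j, p j * p j) + a * ∑ j, (q i j * p j + p j * q i j)) * p i
          + a * (∑ j, p j * p j) * q i i))
      = (2 * u - 2 * a * (∑ j, q j j) - (2/3) * (∑ j, p j * p j)) * (p i * p i)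
        + 2 * a * (w i * p i)
        + (2 * a * u - a ^ 2 * (∑ j, q j j) - (2/3) * a * (∑ j, p j * p j)) * q i i
        + (2 / 3) * a * (∑ j, p i * p j * q i j) + a ^ 2 * (∑ j, q i j * q i j)
        + ((∑ j, a * a * p j * r' i j) - a * a * p i * ∑ j, r i j) := by
    intro i
    rw [e3]
    linear_combination (-(2/3)) * a * e4 i
  simp only [e5]
  simp only [Finset.sum_add_distrib, Finset.sum_sub_distrib, ← Finset.mul_sum] at hR ⊢
  rw [hR, e0]
  ring

section
variable {d : ℕ} (h : ℝ × EuclideanSpace ℝ (Fin d) → ℝ)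

/-- the flux -/
noncomputable def VV (i : Fin d) (z : ℝ × EuclideanSpace ℝ (Fin d)) : ℝ :=
  2 * (h z * DD tt h z * DD (ee i) h z)
  + (-1) * (h z * h z * DD (ee i) h z * ∑ j, DD (ee j) (DD (ee j) h) z)
  + (∑ j, h z * h z * DD (ee j) h z * DD (ee i) (DD (ee j) h) z)
  + (-(2 / 3)) * (h z * (∑ j, DD (ee j) h z * DD (ee j) h z) * DD (ee i) h z)

variable {h}

theorem VV_smooth (hs : ContDiff ℝ ∞ h) (i) : ContDiff ℝ ∞ (VV h i) := by
  have h1 : ∀ v, ContDiff ℝ ∞ (DD v h) := fun v => DD_smooth hs v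
  have h2 : ∀ v w, ContDiff ℝ ∞ (DD v (DD w h)) := fun v w => DD_smooth (h1 w) v
  unfold VV
  fun_prop

theorem VV_per (hs : SPer h) (i) : SPer (VV h i) := by
  intro z k
  have h1 : ∀ v, SPer (DD v h) := fun v => DD_per hs v
  have h2 : ∀ v w, SPer (DD v (DD w h)) := fun v w => DD_per (h1 w) v
  unfold VV
  simp only [hs z k, h1 _ z k, h2 _ _ z k]

theorem VV_div (hs : ContDiff ℝ ∞ h) (i : Fin d) (z) : DD (ee i) (VV h i) z =
    (2 * ((DD (ee i) h z * DD tt h z + h z * DD (ee i) (DD tt h) z) * DD (ee i) h z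
        + h z * DD tt h z * DD (ee i) (DD (ee i) h) z)
      + (-1) * (((DD (ee i) h z * h z + h z * DD (ee i) h z) * DD (ee i) h z
          + h z * h z * DD (ee i) (DD (ee i) h) z) * (∑ j, DD (ee j) (DD (ee j) h) z)
          + h z * h z * DD (ee i) h z * ∑ j, DD (ee i) (DD (ee j) (DD (ee j) h)) z)
      + (∑ j, (((DD (ee i) h z * h z + h z * DD (ee i) h z) * DD (ee j) h z
          + h z * h z * DD (ee i) (DD (ee j) h) z) * DD (ee i) (DD (ee j) h) z
          + h z * h z * DD (ee j) h z * DD (ee i) (DD (ee i) (DD (ee j) h)) z))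
      + (-(2 / 3)) * ((DD (ee i) h z * (∑ j, DD (ee j) h z * DD (ee j) h z)
          + h z * ∑ j, (DD (ee i) (DD (ee j) h) z * DD (ee j) h z
              + DD (ee j) h z * DD (ee i) (DD (ee j) h) z)) * DD (ee i) h z
          + h z * (∑ j, DD (ee j) h z * DD (ee j) h z) * DD (ee i) (DD (ee i) h) z)) := by
  have h1 : ∀ v, ContDiff ℝ ∞ (DD v h) := fun v => DD_smooth hs v
  have h2 : ∀ v w, ContDiff ℝ ∞ (DD v (DD w h)) := fun v w => DD_smooth (h1 w) v
  unfold VV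
  rw [DD_add (by fun_prop) (by fun_prop), DD_add (by fun_prop) (by fun_prop),
    DD_add (by fun_prop) (by fun_prop), DD_const_mul _ (by fun_prop),
    DD_const_mul _ (by fun_prop), DD_const_mul _ (by fun_prop),
    DD_sum _ (by intro j; fun_prop)]
  congr 1
  · congr 1
    · congr 1
      · rw [DD_mul (by fun_prop) (by fun_prop), DD_mul (by fun_prop) (by fun_prop)]
      · rw [DD_mul (by fun_prop) (by fun_prop), DD_mul (by fun_prop) (by fun_prop),
          DD_mul (by fun_prop) (by fun_prop), DD_sum _ (by intro j; fun_prop)]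
    · refine Finset.sum_congr rfl fun j _ => ?_
      rw [DD_mul (by fun_prop) (by fun_prop), DD_mul (by fun_prop) (by fun_prop),
          DD_mul (by fun_prop) (by fun_prop)]
  · rw [DD_mul (by fun_prop) (by fun_prop), DD_mul (by fun_prop) (by fun_prop),
      DD_sum _ (by intro j; fun_prop)]
    congr 5
    refine Finset.sum_congr rfl fun j _ => ?_
    rw [DD_mul (by fun_prop) (by fun_prop)]

end

/-- Dissipation estimate for `∫ h|∇h|²` along the Boussinesq equation
`∂ₜh − div(h∇h) = 0` on `𝕋^d` (inequality `Boussinesq:L2dtn2`). -/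
theorem boussinesq_h_gradsq_decay (d : ℕ) (hd : 1 ≤ d)
    (T : ℝ) (h : ℝ × EuclideanSpace ℝ (Fin d) → ℝ)
    (hsm : ContDiff ℝ (⊤ : ℕ∞) h)
    (hper : ∀ t, ZPeriodic (fun x => h (t, x)))
    (hpos : ∀ t x, 0 < h (t, x))
    (heq : ∀ t ∈ Set.Icc (0 : ℝ) T, ∀ x,
      deriv (fun s => h (s, x)) t
        - (∑ i, pder i (fun y => h (t, y) * pder i (fun z => h (t, z)) y) x) = 0) :
    ∀ t ∈ Set.Icc (0 : ℝ) T,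
      deriv (fun s => ∫ x in fundDom d, h (s, x) * gradSq (fun y => h (s, y)) x) t
        + (1 / 6) * (∫ x in fundDom d, (gradSq (fun z => h (t, z)) x) ^ 2)
        + (1 / 2) * (∫ x in fundDom d, (h (t, x)) ^ 2 * (lap (fun z => h (t, z)) x) ^ 2)
        ≤ 0 := by

  intro t ht
  have hs : ContDiff ℝ ∞ h := hsm
  have h1 : ∀ v, ContDiff ℝ ∞ (DD v h) := fun v => DD_smooth hs v
  have h2 : ∀ v w, ContDiff ℝ ∞ (DD v (DD w h)) := fun v w => DD_smooth (h1 w) v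
  have hP : SPer h := by
    rintro ⟨s, x⟩ k
    have := hper s x k
    simpa using this
  have p1 : ∀ s i, pder i (fun y => h (s, y)) = fun x => DD (ee i) h (s, x) := by
    intro s i; funext x; exact pder_slice hs i s x
  have p2 : ∀ s i j, pder i (fun x => DD (ee j) h (s, x))
      = fun x => DD (ee i) (DD (ee j) h) (s, x) := by
    intro s i j; funext x; exact pder_slice (h1 _) i s x
  have hg : ∀ s x, gradSq (fun y => h (s, y)) x = ∑ j, DD (ee j) h (s, x) * DD (ee j) h (s, x) := by
    intro s x
    simp only [gradSq, p1, pow_two]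
  have hl : ∀ s x, lap (fun y => h (s, y)) x = ∑ j, DD (ee j) (DD (ee j) h) (s, x) := by
    intro s x
    simp only [lap, p1, p2]
  have hu : ∀ x, DD tt h (t, x) = ∑ i, (DD (ee i) h (t, x) * DD (ee i) h (t, x)
      + h (t, x) * DD (ee i) (DD (ee i) h) (t, x)) := by
    intro x
    have := heq t ht x
    rw [(deriv_slice hs t x).deriv, sub_eq_zero] at this
    rw [this]
    refine Finset.sum_congr rfl fun i _ => ?_
    simp only [p1]
    have h3 := pder_slice (F := fun z => h z * DD (ee i) h z) (by fun_prop) i t x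
    rw [h3, DD_mul hs (h1 _)]
  simp only [hg, hl]
  have hL := (leibniz (F := fun z => h z * ∑ j, DD (ee j) h z * DD (ee j) h z)
    (by fun_prop) t).deriv
  rw [hL]
  have hT : ∀ x, DD tt (fun z => h z * ∑ j, DD (ee j) h z * DD (ee j) h z) (t, x)
      = DD tt h (t, x) * (∑ j, DD (ee j) h (t, x) * DD (ee j) h (t, x))
        + h (t, x) * ∑ j, (DD (ee j) (DD tt h) (t, x) * DD (ee j) h (t, x)
          + DD (ee j) h (t, x) * DD (ee j) (DD tt h) (t, x)) := by
    intro x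
    rw [DD_mul hs (by fun_prop), DD_sum _ (by intro j; fun_prop)]
    congr 2
    refine Finset.sum_congr rfl fun j _ => ?_
    rw [DD_mul (h1 _) (h1 _), DD_comm hs tt]
  have hdiv := div_zero_int hd (fun i => VV_smooth hs i) (fun i => VV_per hP i) t
  have c0 := hs.continuous
  have c1 : ∀ v, Continuous (DD v h) := fun v => (h1 v).continuous
  have c2 : ∀ v w, Continuous (DD v (DD w h)) := fun v w => (h2 v w).continuous
  have c3 : ∀ i, Continuous (DD (ee i) (VV h i)) := fun i => (DD_smooth (VV_smooth hs i) _).continuous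
  have c4 : Continuous (DD tt (fun z => h z * ∑ j, DD (ee j) h z * DD (ee j) h z)) :=
    (DD_smooth (by fun_prop) _).continuous
  rw [← hdiv, ← integral_const_mul, ← integral_const_mul,
    ← integral_add (int_cont (by fun_prop)) (int_cont (by fun_prop)),
    ← integral_add (int_cont (by fun_prop)) (int_cont (by fun_prop))]
  refine integral_mono (int_cont (by fun_prop)) (int_cont (by fun_prop)) fun x => ?_
  have key := alg_id (h (t, x)) (DD tt h (t, x)) (fun i => DD (ee i) h (t, x))
    (fun i => DD (ee i) (DD tt h) (t, x)) (fun i j => DD (ee i) (DD (ee j) h) (t, x))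
    (fun i j => DD (ee i) (DD (ee j) (DD (ee j) h)) (t, x))
    (fun i j => DD (ee i) (DD (ee i) (DD (ee j) h)) (t, x))
    (by
      intro i j
      have e : DD (ee i) (DD (ee j) h) = DD (ee j) (DD (ee i) h) :=
        funext fun z => DD_comm hs _ _ z
      show DD (ee i) (DD (ee i) (DD (ee j) h)) (t, x) = DD (ee j) (DD (ee i) (DD (ee i) h)) (t, x)
      rw [e, DD_comm (h1 _)])
    (hu x)
  simp only [← VV_div hs, ← hT] at key
  have n1 : 0 ≤ ∑ i, ∑ j, (h (t, x) * DD (ee i) (DD (ee j) h) (t, x)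
      + DD (ee i) h (t, x) * DD (ee j) h (t, x) / 3) ^ 2 :=
    Finset.sum_nonneg fun i _ => Finset.sum_nonneg fun j _ => sq_nonneg _
  have n2 := sq_nonneg (h (t, x) * (∑ j, DD (ee j) (DD (ee j) h) (t, x))
    + (∑ j, DD (ee j) h (t, x) * DD (ee j) h (t, x)) / 3)
  show _ ≤ _
  simp only []
  linarith
end
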